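/- Let X = (X₁,…,X_d) be a d-tuple of (p+q)×(p+q) complex matrices which is jointly block upper triangular: each X_j = [[Y_j, Z_j],[0, W_j]] with Y_j ∈ M_p(ℂ), W_j ∈ M_q(ℂ), Z_j a p×q block. Then the joint (row) spectral radii satisfy ρ(X) = max(ρ(Y), ρ(W)), where Y = (Y₁,…,Y_d) and W = (W₁,…,W_d). -/

import Mathlib

open Filter Topology
open scoped Matrix

/-- The operator norm of a square complex matrix, viewed as a linear operator on
Euclidean space (largest singular value). -/
noncomputable def opNorm {ι : Type*} [Fintype ι] [DecidableEq ι] (X : Matrix ι ι ℂ) : ℝ :=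
  ‖Matrix.toEuclideanCLM (𝕜 := ℂ) X‖

/-- For a word `w = w₁⋯wₙ`, the ordered product `T_{w₁} T_{w₂} ⋯ T_{wₙ}`. -/
def wordProd {M : Type*} [Monoid M] {d n : ℕ} (T : Fin d → M) (w : Fin n → Fin d) : M :=
  (List.ofFn fun i => T (w i)).prod

section FrobeniusGrowth

attribute [local instance] Matrix.frobeniusNormedAddCommGroup Matrix.frobeniusNormedSpace

variable {ι κ : Type*} [Fintype ι] [Fintype κ]

theorem frobenius_norm_sq_eq_sum (A : Matrix ι κ ℂ) : ‖A‖ ^ 2 = ∑ i, ∑ j, ‖A i j‖ ^ 2 := by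
  rw [Matrix.frobenius_norm_def, ← Real.sqrt_eq_rpow, Real.sq_sqrt]
  · simp
  · positivity

theorem frobenius_norm_sq_eq_trace (A : Matrix ι κ ℂ) :
    ((‖A‖ ^ 2 : ℝ) : ℂ) = (A * Aᴴ).trace := by
  rw [frobenius_norm_sq_eq_sum]
  simp [Matrix.trace, Matrix.mul_apply, Complex.mul_conj, Complex.normSq_eq_norm_sq]

theorem frobenius_norm_sq_fromBlocks {p q : ℕ} (A : Matrix (Fin p) (Fin p) ℂ)
    (B : Matrix (Fin p) (Fin q) ℂ) (D : Matrix (Fin q) (Fin q) ℂ) :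
    ‖Matrix.fromBlocks A B 0 D‖ ^ 2 = ‖A‖ ^ 2 + ‖B‖ ^ 2 + ‖D‖ ^ 2 := by
  simp [frobenius_norm_sq_eq_sum, Finset.sum_add_distrib, add_assoc]

/-- The sum of the squared Frobenius norms of all products of length `m`. -/
noncomputable def wordFrobSq {d : ℕ} [DecidableEq ι] (T : Fin d → Matrix ι ι ℂ) (m : ℕ) : ℝ :=
  ∑ w : Fin m → Fin d, ‖wordProd T w‖ ^ 2

theorem wordFrobSq_nonneg {d : ℕ} [DecidableEq ι] (T : Fin d → Matrix ι ι ℂ) (m : ℕ) :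
    0 ≤ wordFrobSq T m := by
  unfold wordFrobSq; positivity

theorem opNorm_nonneg [DecidableEq ι] (A : Matrix ι ι ℂ) : 0 ≤ opNorm A := norm_nonneg _

theorem opNorm_sum_le [DecidableEq ι] {α : Type*} (s : Finset α) (A : α → Matrix ι ι ℂ) :
    opNorm (∑ a ∈ s, A a) ≤ ∑ a ∈ s, opNorm (A a) := by
  unfold opNorm
  rw [map_sum]
  exact norm_sum_le _ _

theorem opNorm_le_frobenius_norm [DecidableEq ι] (A : Matrix ι ι ℂ) : opNorm A ≤ ‖A‖ := by
  refine ContinuousLinearMap.opNorm_le_bound _ (norm_nonneg _) fun x => ?_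
  have h := Matrix.frobenius_norm_mul A (Matrix.replicateCol Unit x.ofLp)
  rw [← Matrix.replicateCol_mulVec, Matrix.frobenius_norm_replicateCol,
    Matrix.frobenius_norm_replicateCol] at h
  exact h

theorem opNorm_mul_conjTranspose_le [DecidableEq ι] (A : Matrix ι ι ℂ) :
    opNorm (A * Aᴴ) ≤ ‖A‖ ^ 2 := by
  refine (opNorm_le_frobenius_norm _).trans ((Matrix.frobenius_norm_mul _ _).trans_eq ?_)
  rw [Matrix.frobenius_norm_conjTranspose, sq]

theorem norm_apply_le_opNorm [DecidableEq ι] (A : Matrix ι ι ℂ) (i j : ι) :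
    ‖A i j‖ ≤ opNorm A := by
  have h := (Matrix.toEuclideanCLM (𝕜 := ℂ) A).le_opNorm (EuclideanSpace.single j 1)
  have h' := PiLp.norm_apply_le (Matrix.toEuclideanCLM (𝕜 := ℂ) A (EuclideanSpace.single j 1)) i
  simp only [PiLp.norm_single, norm_one, mul_one] at h
  refine le_trans (le_of_eq ?_) (h'.trans h)
  simp [Matrix.ofLp_toEuclideanCLM]

theorem norm_trace_le_opNorm [DecidableEq ι] (A : Matrix ι ι ℂ) :
    ‖A.trace‖ ≤ Fintype.card ι * opNorm A := by
  refine (norm_sum_le _ _).trans ((Finset.sum_le_sum fun i _ => norm_apply_le_opNorm A i i).trans ?_)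
  simp

theorem opNorm_le_wordFrobSq {d : ℕ} [DecidableEq ι] (T : Fin d → Matrix ι ι ℂ) (m : ℕ) :
    opNorm (∑ w : Fin m → Fin d, wordProd T w * (wordProd T w)ᴴ) ≤ wordFrobSq T m :=
  (opNorm_sum_le _ _).trans (Finset.sum_le_sum fun _ _ => opNorm_mul_conjTranspose_le _)

theorem wordFrobSq_le_opNorm {d : ℕ} [DecidableEq ι] (T : Fin d → Matrix ι ι ℂ) (m : ℕ) :
    wordFrobSq T m ≤ Fintype.card ι *
      opNorm (∑ w : Fin m → Fin d, wordProd T w * (wordProd T w)ᴴ) := by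
  refine le_trans (le_of_eq ?_) (norm_trace_le_opNorm _)
  rw [Matrix.trace_sum]
  simp only [← frobenius_norm_sq_eq_trace]
  rw [← Complex.ofReal_sum, Complex.norm_real]
  exact (Real.norm_of_nonneg (wordFrobSq_nonneg T m)).symm

theorem tendsto_const_rpow_inv_two_mul {c : ℝ} (hc : 0 < c) :
    Tendsto (fun m : ℕ => c ^ ((1 : ℝ) / (2 * m))) atTop (𝓝 1) := by
  have h : Tendsto (fun m : ℕ => (1 : ℝ) / (2 * m)) atTop (𝓝 0) :=
    tendsto_const_nhds.div_atTop
      (tendsto_natCast_atTop_atTop.const_mul_atTop (by norm_num : (0 : ℝ) < 2))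
  simpa using tendsto_const_nhds.rpow h (Or.inl hc.ne')

/-- The Frobenius norm computes the same row spectral radius as the operator norm. -/
theorem tendsto_wordFrobSq_rpow {d : ℕ} [DecidableEq ι] {T : Fin d → Matrix ι ι ℂ} {ρ : ℝ}
    (h : Tendsto
      (fun m : ℕ => opNorm (∑ w : Fin m → Fin d, wordProd T w * (wordProd T w)ᴴ)
        ^ ((1 : ℝ) / (2 * m))) atTop (𝓝 ρ)) :
    Tendsto (fun m : ℕ => wordFrobSq T m ^ ((1 : ℝ) / (2 * m))) atTop (𝓝 ρ) := by
  have hc : (0 : ℝ) < Fintype.card ι + 1 := by positivity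
  refine tendsto_of_tendsto_of_tendsto_of_le_of_le h
    (by simpa only [one_mul] using (tendsto_const_rpow_inv_two_mul hc).mul h) (fun m => ?_) (fun m => ?_)
  · exact Real.rpow_le_rpow (opNorm_nonneg _) (opNorm_le_wordFrobSq T m) (by positivity)
  · simp only
    rw [← Real.mul_rpow hc.le (opNorm_nonneg _)]
    refine Real.rpow_le_rpow (wordFrobSq_nonneg T m) ((wordFrobSq_le_opNorm T m).trans ?_)
      (by positivity)
    exact mul_le_mul_of_nonneg_right (by linarith) (opNorm_nonneg _)

theorem exists_le_mul_pow_of_tendsto_rpow {t : ℕ → ℝ} {ρ r : ℝ} (ht : ∀ m, 0 ≤ t m)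
    (h : Tendsto (fun m : ℕ => t m ^ ((1 : ℝ) / (2 * m))) atTop (𝓝 ρ)) (hr : 0 < r) (hρ : ρ < r) :
    ∃ C, 0 ≤ C ∧ ∀ m, t m ≤ C * (r ^ 2) ^ m := by
  have hev : ∀ᶠ m : ℕ in atTop, t m / (r ^ 2) ^ m ≤ 1 := by
    filter_upwards [h.eventually_lt_const hρ, eventually_gt_atTop 0] with m hm hm0
    have hm0' : (m : ℝ) ≠ 0 := by exact_mod_cast hm0.ne'
    rw [div_le_one (by positivity)]
    calc t m = (t m ^ ((1 : ℝ) / (2 * m))) ^ (2 * m) := by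
          rw [← Real.rpow_natCast, ← Real.rpow_mul (ht m)]
          push_cast
          rw [one_div_mul_cancel (by positivity), Real.rpow_one]
      _ ≤ r ^ (2 * m) := pow_le_pow_left₀ (Real.rpow_nonneg (ht m) _) hm.le _
      _ = (r ^ 2) ^ m := pow_mul _ _ _
  obtain ⟨C, hC⟩ := (isBoundedUnder_of_eventually_le hev).bddAbove_range
  refine ⟨C, ?_, fun m => ?_⟩
  · exact (div_nonneg (ht 0) (by positivity)).trans (hC ⟨0, rfl⟩)
  · rw [← div_le_iff₀ (by positivity)]
    exact hC ⟨m, rfl⟩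

theorem le_of_tendsto_rpow_of_le_mul_pow {t : ℕ → ℝ} {ρ r K : ℝ} (ht : ∀ m, 0 ≤ t m)
    (h : Tendsto (fun m : ℕ => t m ^ ((1 : ℝ) / (2 * m))) atTop (𝓝 ρ)) (hr : 0 < r) (hK : 0 ≤ K)
    (hle : ∀ m : ℕ, t m ≤ K * ((m : ℝ) + 1) ^ 2 * (r ^ 2) ^ m) : ρ ≤ r := by
  have hpoly : Tendsto (fun m : ℕ => ((m : ℝ) + 1) ^ ((1 : ℝ) / m)) atTop (𝓝 1) := by
    have h1 := (tendsto_rpow_div_mul_add 1 1 (-1) one_ne_zero.symm).comp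
      (tendsto_atTop_add_const_right atTop (1 : ℝ) tendsto_natCast_atTop_atTop)
    refine h1.congr fun m => ?_
    simp
  have hlim := ((tendsto_const_rpow_inv_two_mul (by linarith : 0 < K + 1)).mul hpoly).mul_const r
  rw [one_mul, one_mul] at hlim
  refine le_of_tendsto_of_tendsto h hlim ?_
  filter_upwards [eventually_gt_atTop 0] with m hm
  have hm0 : (m : ℝ) ≠ 0 := by exact_mod_cast hm.ne'
  have hm1 : (0 : ℝ) ≤ (m : ℝ) + 1 := by positivity
  calc t m ^ ((1 : ℝ) / (2 * m))
      ≤ ((K + 1) * ((m : ℝ) + 1) ^ 2 * (r ^ 2) ^ m) ^ ((1 : ℝ) / (2 * m)) := by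
        refine Real.rpow_le_rpow (ht m) ((hle m).trans ?_) (by positivity)
        gcongr
        linarith
    _ = (K + 1) ^ ((1 : ℝ) / (2 * m)) * ((m : ℝ) + 1) ^ ((1 : ℝ) / m) * r := by
        rw [Real.mul_rpow (by positivity) (by positivity),
          Real.mul_rpow (by positivity) (by positivity), ← pow_mul r, ← Real.rpow_natCast _ 2,
          ← Real.rpow_natCast r, ← Real.rpow_mul hm1, ← Real.rpow_mul hr.le]
        congr 2
        · congr 1
          push_cast
          field_simp
        · push_cast
          rw [mul_one_div_cancel (by positivity), Real.rpow_one]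

theorem wordProd_cons {M : Type*} [Monoid M] {d m : ℕ} (T : Fin d → M) (j : Fin d)
    (w : Fin m → Fin d) : wordProd T (Fin.cons j w : Fin (m + 1) → Fin d) = T j * wordProd T w := by
  simp [wordProd, List.ofFn_succ]

theorem wordProd_snoc {M : Type*} [Monoid M] {d m : ℕ} (T : Fin d → M) (w : Fin m → Fin d)
    (j : Fin d) : wordProd T (Fin.snoc w j : Fin (m + 1) → Fin d) = wordProd T w * T j := by
  rw [wordProd, List.ofFn_succ']
  simp [wordProd]

theorem sum_words_cons {d m : ℕ} (f : (Fin (m + 1) → Fin d) → ℝ) :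
    ∑ w, f w = ∑ j, ∑ w : Fin m → Fin d, f (Fin.cons j w) := by
  rw [← (Fin.consEquiv fun _ => Fin d).sum_comp, Fintype.sum_prod_type]
  rfl

theorem sum_words_snoc {d m : ℕ} (f : (Fin (m + 1) → Fin d) → ℝ) :
    ∑ w, f w = ∑ j, ∑ w : Fin m → Fin d, f (Fin.snoc w j) := by
  rw [← (Fin.snocEquiv fun _ => Fin d).sum_comp, Fintype.sum_prod_type]
  rfl

theorem norm_add_sq_le_weighted {E : Type*} [SeminormedAddCommGroup E] (a b : E) {s : ℝ}
    (hs : 0 < s) : ‖a + b‖ ^ 2 ≤ (1 + 1 / s) * ‖a‖ ^ 2 + (1 + s) * ‖b‖ ^ 2 := by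
  have h1 : ‖a + b‖ ^ 2 ≤ (‖a‖ + ‖b‖) ^ 2 := by gcongr; exact norm_add_le a b
  have h2 : (1 + 1 / s) * ‖a‖ ^ 2 + (1 + s) * ‖b‖ ^ 2 - (‖a‖ + ‖b‖) ^ 2
      = (‖a‖ - s * ‖b‖) ^ 2 / s := by
    field_simp
    ring
  have h3 : 0 ≤ (‖a‖ - s * ‖b‖) ^ 2 / s := by positivity
  linarith

section BlockTriangular

variable {d p q : ℕ} (Y : Fin d → Matrix (Fin p) (Fin p) ℂ) (Z : Fin d → Matrix (Fin p) (Fin q) ℂ)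
  (W : Fin d → Matrix (Fin q) (Fin q) ℂ)

/-- The upper right block of a product of block upper triangular matrices. -/
def offDiag {m : ℕ} (w : Fin m → Fin d) : Matrix (Fin p) (Fin q) ℂ :=
  (wordProd (fun j => Matrix.fromBlocks (Y j) (Z j) 0 (W j)) w).toBlocks₁₂

theorem wordProd_fromBlocks {m : ℕ} (w : Fin m → Fin d) :
    wordProd (fun j => Matrix.fromBlocks (Y j) (Z j) 0 (W j)) w =
      Matrix.fromBlocks (wordProd Y w) (offDiag Y Z W w) 0 (wordProd W w) := by
  induction m with
  | zero => simp [wordProd, offDiag, ← Matrix.fromBlocks_one]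
  | succ m ih =>
    obtain ⟨j, w, rfl⟩ : ∃ j w', w = Fin.cons j w' := ⟨w 0, Fin.tail w, (Fin.cons_self_tail w).symm⟩
    rw [offDiag, wordProd_cons, wordProd_cons, wordProd_cons, ih w, Matrix.fromBlocks_multiply,
      Matrix.toBlocks_fromBlocks₁₂]
    simp

theorem offDiag_zero (w : Fin 0 → Fin d) : offDiag Y Z W w = 0 := by
  simp [wordProd, offDiag, ← Matrix.fromBlocks_one]

theorem offDiag_cons {m : ℕ} (j : Fin d) (w : Fin m → Fin d) :
    offDiag Y Z W (Fin.cons j w : Fin (m + 1) → Fin d) =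
      Y j * offDiag Y Z W w + Z j * wordProd W w := by
  rw [offDiag, wordProd_cons, wordProd_fromBlocks, Matrix.fromBlocks_multiply,
    Matrix.toBlocks_fromBlocks₁₂]

theorem wordFrobSq_fromBlocks (m : ℕ) :
    wordFrobSq (fun j => Matrix.fromBlocks (Y j) (Z j) 0 (W j)) m =
      wordFrobSq Y m + ∑ w : Fin m → Fin d, ‖offDiag Y Z W w‖ ^ 2 + wordFrobSq W m := by
  simp only [wordFrobSq, wordProd_fromBlocks, frobenius_norm_sq_fromBlocks, Finset.sum_add_distrib]

theorem sum_wordProd_mul_offDiag_succ_le (l m : ℕ) {s : ℝ} (hs : 0 < s) :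
    ∑ u : Fin l → Fin d, ∑ w : Fin (m + 1) → Fin d, ‖wordProd Y u * offDiag Y Z W w‖ ^ 2 ≤
      (1 + 1 / s) * ∑ u : Fin (l + 1) → Fin d, ∑ w : Fin m → Fin d,
        ‖wordProd Y u * offDiag Y Z W w‖ ^ 2 +
      (1 + s) * (wordFrobSq Y l * (∑ j, ‖Z j‖ ^ 2) * wordFrobSq W m) := by
  have hprod : wordFrobSq Y l * (∑ j, ‖Z j‖ ^ 2) * wordFrobSq W m =
      ∑ u : Fin l → Fin d, ∑ j, ∑ w : Fin m → Fin d,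
        ‖wordProd Y u‖ ^ 2 * ‖Z j‖ ^ 2 * ‖wordProd W w‖ ^ 2 := by
    simp only [wordFrobSq, ← Finset.mul_sum, ← Finset.sum_mul]
  rw [hprod, sum_words_snoc, Finset.sum_comm (s := (Finset.univ : Finset (Fin d))), Finset.mul_sum,
    Finset.mul_sum, ← Finset.sum_add_distrib]
  refine Finset.sum_le_sum fun u _ => ?_
  rw [sum_words_cons, Finset.mul_sum, Finset.mul_sum, ← Finset.sum_add_distrib]
  refine Finset.sum_le_sum fun j _ => ?_
  rw [Finset.mul_sum, Finset.mul_sum, ← Finset.sum_add_distrib]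
  refine Finset.sum_le_sum fun w _ => ?_
  rw [offDiag_cons, wordProd_snoc, Matrix.mul_add, ← Matrix.mul_assoc]
  refine (norm_add_sq_le_weighted _ _ hs).trans ?_
  have h : ‖wordProd Y u * (Z j * wordProd W w)‖ ≤ ‖wordProd Y u‖ * ‖Z j‖ * ‖wordProd W w‖ := by
    rw [← Matrix.mul_assoc]
    refine (Matrix.frobenius_norm_mul _ _).trans ?_
    gcongr
    exact Matrix.frobenius_norm_mul _ _
  rw [← mul_pow, ← mul_pow]
  gcongr

theorem sum_wordProd_mul_offDiag_le {R C D : ℝ} (hR : 0 < R) (hC : 0 ≤ C) (hD : 0 ≤ D)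
    (hY : ∀ m, wordFrobSq Y m ≤ C * R ^ m) (hW : ∀ m, wordFrobSq W m ≤ D * R ^ m) (m l : ℕ) :
    ∑ u : Fin l → Fin d, ∑ w : Fin m → Fin d, ‖wordProd Y u * offDiag Y Z W w‖ ^ 2 ≤
      C * (∑ j, ‖Z j‖ ^ 2) * D / R * ((m : ℝ) + 1) ^ 2 * R ^ (l + m) := by
  set c := ∑ j, ‖Z j‖ ^ 2 with hc
  have hc0 : 0 ≤ c := by positivity
  induction m generalizing l with
  | zero =>
    simp only [offDiag_zero, Matrix.mul_zero, norm_zero]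
    simp only [ne_eq, OfNat.ofNat_ne_zero, not_false_eq_true, zero_pow, Finset.sum_const_zero]
    positivity
  | succ m ih =>
    have hs : (0 : ℝ) < (m : ℝ) + 1 := by positivity
    have hterm : wordFrobSq Y l * c * wordFrobSq W m ≤ (C * R ^ l) * c * (D * R ^ m) := by
      have := wordFrobSq_nonneg W m
      gcongr
      exacts [hY l, hW m]
    calc _ ≤ _ := sum_wordProd_mul_offDiag_succ_le Y Z W l m hs
      _ ≤ (1 + 1 / ((m : ℝ) + 1)) * (C * c * D / R * ((m : ℝ) + 1) ^ 2 * R ^ (l + 1 + m)) +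
          (1 + ((m : ℝ) + 1)) * ((C * R ^ l) * c * (D * R ^ m)) := by
        gcongr
        exact ih (l + 1)
      _ = _ := by
        push_cast
        field_simp
        ring

theorem wordFrobSq_add_le_fromBlocks (m : ℕ) :
    wordFrobSq Y m + wordFrobSq W m ≤
      wordFrobSq (fun j => Matrix.fromBlocks (Y j) (Z j) 0 (W j)) m := by
  rw [wordFrobSq_fromBlocks]
  have : 0 ≤ ∑ w : Fin m → Fin d, ‖offDiag Y Z W w‖ ^ 2 := by positivity
  linarith

theorem exists_wordFrobSq_fromBlocks_le {R C D : ℝ} (hR : 0 < R) (hC : 0 ≤ C) (hD : 0 ≤ D)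
    (hY : ∀ m, wordFrobSq Y m ≤ C * R ^ m) (hW : ∀ m, wordFrobSq W m ≤ D * R ^ m) :
    ∃ K : ℝ, 0 ≤ K ∧ ∀ m : ℕ, wordFrobSq (fun j => Matrix.fromBlocks (Y j) (Z j) 0 (W j)) m ≤
      K * ((m : ℝ) + 1) ^ 2 * R ^ m := by
  refine ⟨C + C * (∑ j, ‖Z j‖ ^ 2) * D / R + D, by positivity, fun m => ?_⟩
  have hoff := sum_wordProd_mul_offDiag_le Y Z W hR hC hD hY hW m 0
  simp only [wordProd, List.ofFn_zero, List.prod_nil, Matrix.one_mul, zero_add,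
    Fintype.sum_unique] at hoff
  have h1 : (1 : ℝ) ≤ ((m : ℝ) + 1) ^ 2 := one_le_pow₀ (by simp)
  have h2 : (C + D) * R ^ m ≤ (C + D) * ((m : ℝ) + 1) ^ 2 * R ^ m := by
    gcongr
    exact le_mul_of_one_le_right (by positivity) h1
  rw [wordFrobSq_fromBlocks]
  linarith [hY m, hW m]

end BlockTriangular

end FrobeniusGrowth

/-- If `X_j = [[Y_j, Z_j],[0, W_j]]` is jointly block upper triangular, then the joint
(row) spectral radii (the limits `ρ = lim_m ‖Σ_{|w|=m} ⋅^w (⋅^w)^*‖^{1/2m}`) satisfy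
`ρ(X) = max (ρ(Y), ρ(W))`. -/
theorem rowSpecRad_block_triangular (d p q : ℕ)
    (Y : Fin d → Matrix (Fin p) (Fin p) ℂ) (Z : Fin d → Matrix (Fin p) (Fin q) ℂ)
    (W : Fin d → Matrix (Fin q) (Fin q) ℂ) (ρX ρY ρW : ℝ)
    (hX : Tendsto
      (fun m : ℕ => opNorm (∑ w : Fin m → Fin d,
          wordProd (fun j => Matrix.fromBlocks (Y j) (Z j) 0 (W j)) w
            * (wordProd (fun j => Matrix.fromBlocks (Y j) (Z j) 0 (W j)) w)ᴴ)
        ^ ((1 : ℝ) / (2 * m))) atTop (𝓝 ρX))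
    (hY : Tendsto
      (fun m : ℕ => opNorm (∑ w : Fin m → Fin d, wordProd Y w * (wordProd Y w)ᴴ)
        ^ ((1 : ℝ) / (2 * m))) atTop (𝓝 ρY))
    (hW : Tendsto
      (fun m : ℕ => opNorm (∑ w : Fin m → Fin d, wordProd W w * (wordProd W w)ᴴ)
        ^ ((1 : ℝ) / (2 * m))) atTop (𝓝 ρW)) :
    ρX = max ρY ρW := by
  have hX' := tendsto_wordFrobSq_rpow hX
  have hY' := tendsto_wordFrobSq_rpow hY
  have hW' := tendsto_wordFrobSq_rpow hW
  apply le_antisymm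
  · refine le_of_forall_gt_imp_ge_of_dense fun r hr => ?_
    obtain ⟨hYr, hWr⟩ := max_lt_iff.1 hr
    have hr0 : 0 < r := lt_of_le_of_lt
      (ge_of_tendsto' hY' fun m => Real.rpow_nonneg (wordFrobSq_nonneg Y m) _) hYr
    obtain ⟨C, hC0, hC⟩ := exists_le_mul_pow_of_tendsto_rpow (wordFrobSq_nonneg Y) hY' hr0 hYr
    obtain ⟨D, hD0, hD⟩ := exists_le_mul_pow_of_tendsto_rpow (wordFrobSq_nonneg W) hW' hr0 hWr
    obtain ⟨K, hK0, hK⟩ :=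
      exists_wordFrobSq_fromBlocks_le Y Z W (by positivity : 0 < r ^ 2) hC0 hD0 hC hD
    exact le_of_tendsto_rpow_of_le_mul_pow (wordFrobSq_nonneg _) hX' hr0 hK0 hK
  · refine max_le (le_of_tendsto_of_tendsto' hY' hX' fun m => ?_)
      (le_of_tendsto_of_tendsto' hW' hX' fun m => ?_)
    · exact Real.rpow_le_rpow (wordFrobSq_nonneg Y m)
        (by linarith [wordFrobSq_add_le_fromBlocks Y Z W m, wordFrobSq_nonneg W m]) (by positivity)
    · exact Real.rpow_le_rpow (wordFrobSq_nonneg W m)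
        (by linarith [wordFrobSq_add_le_fromBlocks Y Z W m, wordFrobSq_nonneg Y m]) (by positivity)
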